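/- Let c_0 ∈ ℂ be a root of the Gleason polynomial G_{2,n} for some n ≥ 3, and set K = ℚ(c_0). Then there exists N ≥ 1 such that the Galois group of the splitting field of f_{2,c_0}^N over K is non-abelian; equivalently, the arboreal Galois group G_∞(f_{2,c_0}, 0) is non-abelian. -/

import Mathlib

open Polynomial IntermediateField

noncomputable section

/-- The value sequence `a_i(c)`: `a_0 = 0`, `a_{i+1} = a_i ^ d + c`. -/
def aSeq (d : ℕ) {F : Type*} [CommRing F] (c : F) : ℕ → F
  | 0 => 0
  | i + 1 => aSeq d c i ^ d + c

/-- The polynomials `a_i ∈ ℤ[c]`: `a_0 = 0`, `a_{i+1} = a_i ^ d + c`. -/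
def aPoly (d : ℕ) : ℕ → Polynomial ℤ
  | 0 => 0
  | i + 1 => aPoly d i ^ d + X

/-- Iterates of `f_{d,c} = x^d + c`: `f^0 = x`, `f^{k+1} = f ∘ f^k`. -/
def fIter (d : ℕ) {F : Type*} [CommRing F] (c : F) : ℕ → Polynomial F
  | 0 => X
  | k + 1 => fIter d c k ^ d + C c

/-- `c₀` is a root of the Gleason polynomial `G_{d,n} = ∏_{k ∣ n} a_k^{μ(n/k)}`. -/
def isGleasonRoot (d n : ℕ) (c₀ : ℂ) : Prop :=
  ∃ g : Polynomial ℤ,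
    g * ∏ k ∈ n.divisors, aPoly d k ^ ((-(ArithmeticFunction.moebius (n / k))).toNat)
        = ∏ k ∈ n.divisors, aPoly d k ^ ((ArithmeticFunction.moebius (n / k)).toNat)
    ∧ Polynomial.aeval c₀ g = 0

/-- `c₀` is a root of the Misiurewicz polynomial `G_{d,m,n}^ζ`. -/
def isMisiurewiczRoot (d m n : ℕ) (ζ c₀ : ℂ) : Prop :=
  ∃ g : Polynomial ℂ,
    g * ((∏ k ∈ n.divisors,
            ((aPoly d (m + k - 1)).map (Int.castRingHom ℂ) -
              C ζ * (aPoly d (m - 1)).map (Int.castRingHom ℂ))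
                ^ ((-(ArithmeticFunction.moebius (n / k))).toNat)) *
          (if n ∣ (m - 1) then
            ∏ k ∈ n.divisors, ((aPoly d k).map (Int.castRingHom ℂ))
                ^ ((ArithmeticFunction.moebius (n / k)).toNat)
          else 1))
        = (∏ k ∈ n.divisors,
            ((aPoly d (m + k - 1)).map (Int.castRingHom ℂ) -
              C ζ * (aPoly d (m - 1)).map (Int.castRingHom ℂ))
                ^ ((ArithmeticFunction.moebius (n / k)).toNat)) *
          (if n ∣ (m - 1) then
            ∏ k ∈ n.divisors, ((aPoly d k).map (Int.castRingHom ℂ))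
                ^ ((-(ArithmeticFunction.moebius (n / k))).toNat)
          else 1)
    ∧ g.eval c₀ = 0

/-- The polynomial `F_{k,i}^{(d,c₀)} = ∏_{j=1}^{d-1} (f_{d,c₀}^k - ζ^j a_i(c₀))` over `ℂ`. -/
def FPoly (d : ℕ) (c₀ ζ : ℂ) (k i : ℕ) : Polynomial ℂ :=
  ∏ j ∈ Finset.Icc 1 (d - 1), (fIter d c₀ k - C (ζ ^ j * aSeq d c₀ i))


open scoped NumberField

/-- A dihedral configuration: a non-commuting pair exists unless one of three elements of the base
field is a square. -/
lemma exists_isSquare_of_forall_commute {K E : Type*} [Field K] [CharZero K] [Field E] [Algebra K E]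
    [FiniteDimensional K E] [IsGalois K E] (hcomm : ∀ σ τ : E ≃ₐ[K] E, σ * τ = τ * σ)
    (b w c : K) (hw : w ≠ 0) (hbw : w = c ^ 2 - b) (β γ δ : E)
    (hβ : β ^ 2 = algebraMap K E b) (hγ : γ ^ 2 = β - algebraMap K E c)
    (hδ : δ ^ 2 = -β - algebraMap K E c) :
    IsSquare b ∨ IsSquare w ∨ IsSquare (w * b) := by
  have hs : (γ * δ) ^ 2 = algebraMap K E w := by
    rw [hbw, map_sub, map_pow, ← hβ, mul_pow, hγ, hδ]; ring
  have hsq : ∀ (x : E) (y : K), x ^ 2 = algebraMap K E y →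
      (∀ σ : E ≃ₐ[K] E, σ x = x) → IsSquare y := by
    intro x y hxy hx
    obtain ⟨z, rfl⟩ := (IsGalois.mem_range_algebraMap_iff_fixed x).2 hx
    refine ⟨z, (algebraMap K E).injective ?_⟩
    rw [← hxy, map_mul, sq]
  have hsgn : ∀ (σ : E ≃ₐ[K] E) (x z : E), x ^ 2 = z → σ z = z → σ x = x ∨ σ x = -x := by
    intro σ x z hx hz
    apply sq_eq_sq_iff_eq_or_eq_neg.1
    rw [← map_pow, hx, hz]
  by_cases hall : ∀ σ : E ≃ₐ[K] E, σ β = β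
  · exact Or.inl (hsq β b hβ hall)
  obtain ⟨σ₀, hσ₀⟩ := not_forall.1 hall
  have hβsgn : ∀ σ : E ≃ₐ[K] E, σ β = β ∨ σ β = -β :=
    fun σ => hsgn σ β _ hβ (σ.commutes b)
  have hssgn : ∀ σ : E ≃ₐ[K] E, σ (γ * δ) = γ * δ ∨ σ (γ * δ) = -(γ * δ) :=
    fun σ => hsgn σ _ _ hs (σ.commutes w)
  have hσ₀' := (hβsgn σ₀).resolve_left hσ₀
  have hs0 : γ * δ ≠ 0 := by
    intro h
    rw [h, zero_pow two_ne_zero, eq_comm, map_eq_zero] at hs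
    exact hw hs
  have hγ0 : γ ≠ 0 := left_ne_zero_of_mul hs0
  have hδ0 : δ ≠ 0 := right_ne_zero_of_mul hs0
  have : CharZero E := charZero_of_injective_algebraMap (algebraMap K E).injective
  have hfix : ∀ σ : E ≃ₐ[K] E, σ β = β → σ (γ * δ) = γ * δ := by
    intro σ hσ
    refine (hssgn σ).resolve_right fun hneg => ?_
    have h0 : σ₀ γ = δ ∨ σ₀ γ = -δ := by
      apply sq_eq_sq_iff_eq_or_eq_neg.1
      rw [← map_pow, hγ, hδ, map_sub, σ₀.commutes, hσ₀']
    have h1 : σ γ = γ ∨ σ γ = -γ := hsgn σ γ _ hγ (by rw [map_sub, σ.commutes, hσ])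
    have h2 : σ δ = δ ∨ σ δ = -δ := hsgn σ δ _ hδ (by rw [map_sub, map_neg, σ.commutes, hσ])
    have hc : σ (σ₀ γ) = σ₀ (σ γ) := DFunLike.congr_fun (hcomm σ σ₀) γ
    have e1 : -δ ≠ δ := fun h => hδ0 (neg_eq_self.1 h)
    have e2 : -(γ * δ) ≠ γ * δ := fun h => hs0 (neg_eq_self.1 h)
    rcases h0 with h0 | h0 <;> rcases h1 with h1 | h1 <;> rcases h2 with h2 | h2 <;>
      simp only [map_mul, map_neg, h0, h1, h2, neg_mul, mul_neg, neg_neg] at hc hneg <;>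
      first
        | exact e1 hc
        | exact e1 hc.symm
        | exact e2 hneg.symm
  right
  rcases hssgn σ₀ with h | h
  · left
    refine hsq _ w hs fun σ => ?_
    rcases hβsgn σ with hσ | hσ
    · exact hfix σ hσ
    · have := hfix (σ * σ₀) (by simp [hσ₀', hσ])
      rwa [AlgEquiv.mul_apply, h] at this
  · right
    refine hsq (γ * δ * β) (w * b) (by rw [mul_pow, hs, hβ, map_mul]) fun σ => ?_
    rcases hβsgn σ with hσ | hσ
    · rw [map_mul, hfix σ hσ, hσ]
    · have := hfix (σ * σ₀) (by simp [hσ₀', hσ])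
      rw [AlgEquiv.mul_apply, h, map_neg] at this
      rw [map_mul, hσ, neg_eq_iff_eq_neg.1 this, neg_mul_neg]

lemma mem_of_mul_mem_sq {R : Type*} [CommRing R] (P : Ideal R) [hP : P.IsMaximal] {a b : R}
    (h : a * b ∈ P ^ 2) : a ∈ P ^ 2 ∨ b ∈ P := by
  by_contra! hcon
  obtain ⟨t, ht⟩ := hP.exists_inv hcon.2
  obtain ⟨u, hu, hut⟩ := ht
  have hsq : a = a * b * (t * (2 - t * b)) + a * u ^ 2 := by
    linear_combination (-(a * (1 - t * b + u))) * hut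
  exact hcon.1 (hsq ▸ Ideal.add_mem _ (Ideal.mul_mem_right _ _ h)
    (Ideal.mul_mem_left _ _ (Ideal.pow_mem_pow hu 2)))

section PrimeOverTwo

variable {K : Type*} [Field K] (P : Ideal (𝓞 K)) [hP : P.IsMaximal]

lemma not_isSquare_two_mul (h2 : (2 : 𝓞 K) ∈ P) (h22 : (2 : 𝓞 K) ∉ P ^ 2) (w : 𝓞 K)
    (hw : w ∉ P) : ¬ IsSquare (algebraMap (𝓞 K) K (2 * w)) := by
  rintro ⟨y, hy⟩
  have hint : IsIntegral ℤ y := by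
    refine IsIntegral.of_pow (n := 2) two_pos ?_
    rw [sq, ← hy]
    exact NumberField.RingOfIntegers.isIntegral_coe _
  obtain ⟨z, rfl⟩ : ∃ z : 𝓞 K, algebraMap (𝓞 K) K z = y := ⟨⟨y, hint⟩, rfl⟩
  rw [← map_mul] at hy
  replace hy := NumberField.RingOfIntegers.coe_injective hy
  have hz : z ∈ P := by
    have : z * z ∈ P := hy ▸ P.mul_mem_right _ h2
    exact (or_self_iff.1 (hP.isPrime.mem_or_mem this))
  have hzz : 2 * w ∈ P ^ 2 := by rw [hy, sq]; exact Ideal.mul_mem_mul hz hz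
  exact hw ((mem_of_mul_mem_sq P hzz).resolve_left h22)

lemma not_isSquare_neg_mul_add_two (h2 : (2 : 𝓞 K) ∈ P) (h22 : (2 : 𝓞 K) ∉ P ^ 2) (c : 𝓞 K)
    (hc : c ∉ P) (hc1 : c + 1 ∉ P) : ¬ IsSquare (algebraMap (𝓞 K) K (-(c * (c + 2)))) := by
  rintro ⟨y, hy⟩
  have hint : IsIntegral ℤ y := by
    refine IsIntegral.of_pow (n := 2) two_pos ?_
    rw [sq, ← hy]
    exact NumberField.RingOfIntegers.isIntegral_coe _
  obtain ⟨z, rfl⟩ : ∃ z : 𝓞 K, algebraMap (𝓞 K) K z = y := ⟨⟨y, hint⟩, rfl⟩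
  rw [← map_mul] at hy
  replace hy := NumberField.RingOfIntegers.coe_injective hy
  have hsq : 2 * (c * (z - 1)) = (z + c) * (z + c) := by linear_combination hy
  have hzc : z + c ∈ P := by
    have : (z + c) * (z + c) ∈ P := hsq ▸ P.mul_mem_right _ h2
    exact (or_self_iff.1 (hP.isPrime.mem_or_mem this))
  have hzz : 2 * (c * (z - 1)) ∈ P ^ 2 := by rw [hsq, sq]; exact Ideal.mul_mem_mul hzc hzc
  have hz1 : z - 1 ∈ P := (hP.isPrime.mem_or_mem
    ((mem_of_mul_mem_sq P hzz).resolve_left h22)).resolve_left hc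
  have : c + 1 = (z + c) - (z - 1) := by ring
  exact hc1 (this ▸ P.sub_mem hzc hz1)

end PrimeOverTwo

/-- If `c` is a root of an integral polynomial whose derivative at `c` is congruent to `1` mod `2`
and `c` generates the number field `K`, then `K` is unramified at `2`. -/
lemma two_notMem_sq {K : Type*} [Field K] [NumberField K] (P : Ideal (𝓞 K))
    (c : 𝓞 K) (hc : Algebra.adjoin ℚ {algebraMap (𝓞 K) K c} = ⊤)
    (p : ℤ[X]) (hp : aeval c p = 0) (hp' : aeval c (derivative p) ∉ P) : (2 : 𝓞 K) ∉ P ^ 2 := by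
  intro h22
  have : (Ideal.span {(2 : ℤ)}).IsMaximal :=
    PrincipalIdealRing.isMaximal_of_irreducible Int.prime_two.irreducible
  have hpd := pow_sub_one_dvd_differentIdeal ℤ (p := Ideal.span {2}) P 2 (by simp) (by
    rw [Ideal.map_span, Ideal.dvd_iff_le, Ideal.span_le]
    simpa using h22)
  rw [Nat.add_one_sub_one, pow_one, Ideal.dvd_iff_le] at hpd
  have hm := hpd (aeval_derivative_mem_differentIdeal ℤ ℚ K c hc)
  obtain ⟨q, hq⟩ := minpoly.isIntegrallyClosed_dvd (NumberField.RingOfIntegers.isIntegral c) hp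
  apply hp'
  rw [hq, derivative_mul, map_add, map_mul, map_mul, minpoly.aeval, zero_mul, add_zero]
  exact P.mul_mem_right _ hm

lemma sum_moebius_div_of_dvd (d n : ℕ) (hn : 0 < n) :
    ∑ k ∈ n.divisors, ArithmeticFunction.moebius (n / k) * (if d ∣ k then 1 else 0)
      = if n = d then 1 else 0 := by
  have := (ArithmeticFunction.sum_eq_iff_sum_mul_moebius_eq (R := ℤ)
    (f := fun i => if i = d then 1 else 0) (g := fun i => if d ∣ i then 1 else 0)).1
    (fun m hm => by simp [Finset.sum_ite_eq', hm.ne']) n hn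
  rw [← this]
  exact (Nat.sum_divisorsAntidiagonal' (fun x y => ((ArithmeticFunction.moebius x : ℤ) : ℤ) *
    (if d ∣ y then 1 else 0))).symm

lemma rootMultiplicity_prod_pow {F ι : Type*} [Field F] (s : Finset ι) (p : ι → F[X])
    (e : ι → ℕ) (x : F) (hp : ∀ i ∈ s, p i ≠ 0) :
    (∏ i ∈ s, p i ^ e i).rootMultiplicity x = ∑ i ∈ s, e i * (p i).rootMultiplicity x := by
  classical
  rw [← count_roots, roots_prod _ _ (Finset.prod_ne_zero_iff.2 fun i hi => pow_ne_zero _ (hp i hi)),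
    Multiset.count_bind]
  exact congrArg Multiset.sum (Multiset.map_congr rfl fun i _ => by simp)

lemma derivative_aPoly_zmod_two (k : ℕ) :
    derivative ((aPoly 2 (k + 1)).map (Int.castRingHom (ZMod 2))) = 1 := by
  have h : (2 : ZMod 2) = 0 := rfl
  simp [aPoly, derivative_pow, h]

lemma rootMultiplicity_aPoly_zmod_two (k : ℕ) (hk : k ≠ 0) (x : ZMod 2) :
    ((aPoly 2 k).map (Int.castRingHom (ZMod 2))).rootMultiplicity x =
      if ((aPoly 2 k).map (Int.castRingHom (ZMod 2))).eval x = 0 then 1 else 0 := by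
  obtain ⟨k, rfl⟩ := Nat.exists_eq_succ_of_ne_zero hk
  have hd := derivative_aPoly_zmod_two k
  set p := (aPoly 2 (k + 1)).map (Int.castRingHom (ZMod 2)) with hp
  have hp0 : p ≠ 0 := by
    intro h
    simp [h] at hd
  split_ifs with h
  · have h1 := (rootMultiplicity_pos hp0).2 h
    have h2 : ¬ 1 < p.rootMultiplicity x := by
      rw [one_lt_rootMultiplicity_iff_isRoot hp0, hd]
      simp [IsRoot]
    change p.rootMultiplicity x = 1
    omega
  · exact rootMultiplicity_eq_zero h

lemma aPoly_ne_zero_zmod_two (k : ℕ) (hk : k ≠ 0) :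
    (aPoly 2 k).map (Int.castRingHom (ZMod 2)) ≠ 0 := by
  obtain ⟨k, rfl⟩ := Nat.exists_eq_succ_of_ne_zero hk
  intro h
  simpa [h] using derivative_aPoly_zmod_two k

/-- A cofactor of Möbius type over the `aPoly 2 k`, `k ∣ n`, does not vanish modulo `2` at a point
where `aPoly 2 k` vanishes modulo `2` exactly for the multiples `k` of some `d ≠ n`. -/
lemma gleason_eval_zmod_two_ne_zero (n d : ℕ) (hn : 0 < n) (hnd : n ≠ d) (x : ZMod 2)
    (hx : ∀ k, ((aPoly 2 k).map (Int.castRingHom (ZMod 2))).eval x = 0 ↔ d ∣ k)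
    (g : ℤ[X])
    (hg : g * ∏ k ∈ n.divisors, aPoly 2 k ^ ((-(ArithmeticFunction.moebius (n / k))).toNat)
        = ∏ k ∈ n.divisors, aPoly 2 k ^ ((ArithmeticFunction.moebius (n / k)).toNat)) :
    (g.map (Int.castRingHom (ZMod 2))).eval x ≠ 0 := by
  have hne : ∀ k ∈ n.divisors, (aPoly 2 k).map (Int.castRingHom (ZMod 2)) ≠ 0 := fun k hk =>
    aPoly_ne_zero_zmod_two k (Nat.pos_of_mem_divisors hk).ne'
  have hg' := congrArg (Polynomial.map (Int.castRingHom (ZMod 2))) hg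
  simp only [Polynomial.map_mul, Polynomial.map_prod, Polynomial.map_pow] at hg'
  have hrhs := Finset.prod_ne_zero_iff.2 fun k hk =>
    pow_ne_zero ((ArithmeticFunction.moebius (n / k)).toNat) (hne k hk)
  have hg0 : g.map (Int.castRingHom (ZMod 2)) ≠ 0 := by
    intro h
    rw [h, zero_mul] at hg'
    exact hrhs hg'.symm
  have hr := congrArg (rootMultiplicity x) hg'
  rw [rootMultiplicity_mul (by rw [hg']; exact hrhs), rootMultiplicity_prod_pow _ _ _ _ hne,
    rootMultiplicity_prod_pow _ _ _ _ hne] at hr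
  have hm := sum_moebius_div_of_dvd d n hn
  rw [if_neg hnd] at hm
  have hsum : ∑ k ∈ n.divisors, (ArithmeticFunction.moebius (n / k)).toNat *
        ((aPoly 2 k).map (Int.castRingHom (ZMod 2))).rootMultiplicity x
      = ∑ k ∈ n.divisors, (-(ArithmeticFunction.moebius (n / k))).toNat *
        ((aPoly 2 k).map (Int.castRingHom (ZMod 2))).rootMultiplicity x := by
    zify
    rw [← sub_eq_zero, ← Finset.sum_sub_distrib, ← hm]
    refine Finset.sum_congr rfl fun k hk => ?_
    rw [rootMultiplicity_aPoly_zmod_two k (Nat.pos_of_mem_divisors hk).ne', ← sub_mul,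
      Int.toNat_sub_toNat_neg]
    simp only [hx]
    split_ifs <;> simp
  rw [hsum] at hr
  intro h0
  have := (rootMultiplicity_pos hg0).2 h0
  omega

lemma eval_zero_aPoly_zmod_two (k : ℕ) :
    ((aPoly 2 k).map (Int.castRingHom (ZMod 2))).eval 0 = 0 := by
  induction k with
  | zero => simp [aPoly]
  | succ k ih => simp [aPoly] at ih ⊢; simp [ih]

lemma eval_one_aPoly_zmod_two (k : ℕ) :
    ((aPoly 2 k).map (Int.castRingHom (ZMod 2))).eval 1 = k := by
  induction k with
  | zero => simp [aPoly]
  | succ k ih =>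
    have h : ∀ t : ZMod 2, t ^ 2 = t := by decide
    simp [aPoly, h] at ih ⊢; simp [ih]

lemma aeval_aPoly {R : Type*} [CommRing R] (d : ℕ) (c : R) (k : ℕ) :
    aeval c (aPoly d k) = aSeq d c k := by
  induction k with
  | zero => simp [aPoly, aSeq]
  | succ k ih => simp [aPoly, aSeq, ih]

lemma map_aSeq {R S : Type*} [CommRing R] [CommRing S] (φ : R →+* S) (d : ℕ) (c : R) (k : ℕ) :
    φ (aSeq d c k) = aSeq d (φ c) k := by
  induction k with
  | zero => simp [aSeq]
  | succ k ih => simp [aSeq, ih]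

lemma aSeq_eq_zero_of_dvd {R : Type*} [CommRing R] (d : ℕ) (c : R) {k n : ℕ} (hkn : k ∣ n)
    (hk : aSeq d c k = 0) : aSeq d c n = 0 := by
  have hadd : ∀ m, aSeq d c (k + m) = aSeq d c m := by
    intro m
    induction m with
    | zero => simpa [aSeq] using hk
    | succ m ih => rw [← add_assoc, aSeq, aSeq, ih]
  obtain ⟨j, rfl⟩ := hkn
  induction j with
  | zero => simp [aSeq]
  | succ j ih => rw [mul_add_one, add_comm, hadd, ih]

lemma eval_fIter_succ {R : Type*} [CommRing R] (d : ℕ) (c x : R) (k : ℕ) :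
    (fIter d c (k + 1)).eval x = (fIter d c k).eval (x ^ d + c) := by
  induction k with
  | zero => simp [fIter]
  | succ k ih => rw [fIter, eval_add, eval_pow, ih, fIter]; simp

lemma eval_fIter_aSeq {R : Type*} [CommRing R] (d : ℕ) (c : R) (k m : ℕ) :
    (fIter d c k).eval (aSeq d c m) = aSeq d c (k + m) := by
  induction k with
  | zero => simp [fIter]
  | succ k ih => rw [fIter, eval_add, eval_pow, ih, eval_C, Nat.add_right_comm, aSeq]

lemma map_fIter {R S : Type*} [CommRing R] [CommRing S] (φ : R →+* S) (d : ℕ) (c : R) (k : ℕ) :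
    (fIter d c k).map φ = fIter d (φ c) k := by
  induction k with
  | zero => simp [fIter]
  | succ k ih => simp [fIter, ih]

lemma monic_sq_add {R : Type*} [CommRing R] [Nontrivial R] (p q : R[X]) (hp : p.Monic)
    (hp1 : 1 ≤ p.natDegree) (hq : q.natDegree ≤ 1) :
    (p ^ 2 + q).Monic ∧ 1 ≤ (p ^ 2 + q).natDegree := by
  have hlt : q.natDegree < (p ^ 2).natDegree := by rw [hp.natDegree_pow 2]; omega
  refine ⟨(hp.pow 2).add_of_left (degree_lt_degree hlt), ?_⟩
  rw [natDegree_add_eq_left_of_natDegree_lt hlt]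
  omega

lemma monic_aPoly_two (k : ℕ) :
    (aPoly 2 (k + 1)).Monic ∧ 1 ≤ (aPoly 2 (k + 1)).natDegree := by
  induction k with
  | zero => simp [aPoly, monic_X]
  | succ k ih => exact monic_sq_add _ _ ih.1 ih.2 natDegree_X_le

lemma monic_fIter_two {R : Type*} [CommRing R] [Nontrivial R] (c : R) (k : ℕ) :
    (fIter 2 c k).Monic ∧ 1 ≤ (fIter 2 c k).natDegree := by
  induction k with
  | zero => simp [fIter, monic_X]
  | succ k ih => exact monic_sq_add _ _ ih.1 ih.2 (by simp)

/-- If `x ^ 2 + c = β`, `β ^ 2 + c = -a₂` and `a_n = 0`, then `x` is a root of the `n`-th iterate. -/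
lemma eval_fIter_eq_zero {R : Type*} [CommRing R] (c β x : R) (n : ℕ) (hn : 3 ≤ n)
    (h0 : aSeq 2 c n = 0) (hβ : β ^ 2 + c = -aSeq 2 c 2) (hx : x ^ 2 + c = β) :
    (fIter 2 c n).eval x = 0 := by
  obtain ⟨m, rfl⟩ := Nat.exists_eq_add_of_le' hn
  rw [eval_fIter_succ, hx, eval_fIter_succ, hβ, eval_fIter_succ, neg_sq]
  exact (eval_fIter_aSeq 2 c m 3).trans h0

lemma aeval_derivative_aPoly_two_notMem {R : Type*} [CommRing R] (P : Ideal R) (hP : P ≠ ⊤)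
    (h2 : (2 : R) ∈ P) (c : R) (k : ℕ) : aeval c (derivative (aPoly 2 (k + 1))) ∉ P := by
  rw [aPoly, derivative_add, derivative_X, derivative_pow]
  intro h
  simp only [map_add, map_mul, Nat.cast_ofNat, map_one, mul_assoc] at h
  refine hP (P.eq_top_iff_one.2 ((P.add_mem_iff_right ?_).1 h))
  refine P.mul_mem_right _ ?_
  simpa only [map_ofNat, Nat.cast_ofNat] using h2

/-- A root of `g` cannot be congruent to an integer `a` with `g(a)` odd modulo a prime over `2`. -/
lemma sub_intCast_notMem {R : Type*} [CommRing R] (P : Ideal R) (hP : P ≠ ⊤)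
    (h2 : (2 : R) ∈ P) (c : R) (g : ℤ[X]) (hg : aeval c g = 0) (a : ℤ)
    (ha : (g.map (Int.castRingHom (ZMod 2))).eval (a : ZMod 2) ≠ 0) : c - a ∉ P := by
  intro hca
  have hga : ((g.eval a : ℤ) : R) ∈ P := by
    have hd := sub_dvd_eval_sub c (a : R) (g.map (Int.castRingHom R))
    rw [show (g.map (Int.castRingHom R)).eval c = 0 from
      (eval_map_algebraMap g c).trans hg, zero_sub, dvd_neg, eval_intCast_map] at hd
    exact P.mem_of_dvd hd hca
  rw [eval_intCast_map, eq_intCast, ne_eq, ZMod.intCast_zmod_eq_zero_iff_dvd] at ha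
  obtain ⟨m, hm⟩ := Int.not_even_iff_odd.1 (mt even_iff_two_dvd.1 ha)
  rw [Int.cast_id] at hm
  rw [hm] at hga
  push_cast at hga
  exact hP (P.eq_top_iff_one.2 ((P.add_mem_iff_right (P.mul_mem_right _ h2)).1 hga))

lemma exists_isMaximal_two_mem (K : Type*) [Field K] [NumberField K] :
    ∃ P : Ideal (𝓞 K), P.IsMaximal ∧ (2 : 𝓞 K) ∈ P := by
  have : (Ideal.span {(2 : ℤ)}).IsMaximal :=
    PrincipalIdealRing.isMaximal_of_irreducible Int.prime_two.irreducible
  obtain ⟨P, hP, hlies⟩ := Ideal.exists_maximal_ideal_liesOver_of_isIntegral (S := 𝓞 K)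
    (Ideal.span {(2 : ℤ)})
  refine ⟨P, hP, ?_⟩
  have := (Ideal.mem_of_liesOver P (Ideal.span {(2 : ℤ)}) 2).1 (Ideal.mem_span_singleton_self _)
  simpa using this

/-- For a Gleason parameter `c₀` of period `n ≥ 3` for `d = 2` and
`K = ℚ(c₀)`, some iterated Galois group `Gal(f_{2,c₀}^N / K)` is non-abelian (equivalently,
the arboreal Galois group `G_∞(f_{2,c₀}, 0)` is non-abelian). -/
theorem stmt5 (n : ℕ) (hn : 3 ≤ n)
    (c₀ : ℂ) (hc₀ : isGleasonRoot 2 n c₀) :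
    ∃ N : ℕ, 1 ≤ N ∧
      ∃ σ τ : (fIter 2 (IntermediateField.AdjoinSimple.gen ℚ c₀) N).Gal,
        σ * τ ≠ τ * σ := by

  have hroot : aSeq 2 c₀ n = 0 := by
    obtain ⟨g, hg, hg0⟩ := hc₀
    have h := congrArg (aeval c₀) hg
    rw [map_mul, hg0, zero_mul, map_prod, eq_comm, Finset.prod_eq_zero_iff] at h
    obtain ⟨k, hk, hk0⟩ := h
    rw [map_pow, aeval_aPoly] at hk0
    exact aSeq_eq_zero_of_dvd 2 c₀ (Nat.dvd_of_mem_divisors hk) (eq_zero_of_pow_eq_zero hk0)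
  obtain ⟨k, rfl⟩ : ∃ k, n = k + 1 := ⟨n - 1, by omega⟩
  have hint₀ : IsIntegral ℤ c₀ :=
    ⟨aPoly 2 (k + 1), (monic_aPoly_two k).1, by rw [← aeval_def, aeval_aPoly, hroot]⟩
  have : FiniteDimensional ℚ ℚ⟮c₀⟯ := adjoin.finiteDimensional hint₀.tower_top
  have : NumberField ℚ⟮c₀⟯ := { }
  set K := ℚ⟮c₀⟯
  set c := IntermediateField.AdjoinSimple.gen ℚ c₀ with hc
  have hcc : algebraMap K ℂ c = c₀ := IntermediateField.AdjoinSimple.algebraMap_gen ℚ c₀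
  have hinj : Function.Injective (algebraMap K ℂ) := (algebraMap K ℂ).injective
  have hcint : IsIntegral ℤ c := (isIntegral_algebraMap_iff hinj).1 (hcc ▸ hint₀)
  obtain ⟨r, hr⟩ : ∃ r : 𝓞 K, algebraMap (𝓞 K) K r = c := ⟨⟨c, hcint⟩, rfl⟩
  have hrc₀ : (algebraMap K ℂ) (algebraMap (𝓞 K) K r) = c₀ := by rw [hr, hcc]
  have hrinj : Function.Injective ((algebraMap K ℂ).comp (algebraMap (𝓞 K) K)) :=
    hinj.comp NumberField.RingOfIntegers.coe_injective
  have hroot' : aSeq 2 r (k + 1) = 0 := by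
    apply hrinj
    rw [map_aSeq, map_zero, RingHom.comp_apply, hrc₀, hroot]
  have hrootc : aSeq 2 c (k + 1) = 0 := by rw [← hr, ← map_aSeq, hroot', map_zero]
  have hadj : Algebra.adjoin ℚ {algebraMap (𝓞 K) K r} = ⊤ := by
    rw [hr]
    have := (IntermediateField.adjoin.powerBasis (K := ℚ) hint₀.tower_top).adjoin_gen_eq_top
    rwa [IntermediateField.adjoin.powerBasis_gen] at this
  obtain ⟨P, hP, h2⟩ := exists_isMaximal_two_mem K
  have h22 : (2 : 𝓞 K) ∉ P ^ 2 := two_notMem_sq P r hadj (aPoly 2 (k + 1))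
    (by rw [aeval_aPoly, hroot']) (aeval_derivative_aPoly_two_notMem P hP.ne_top h2 r k)
  obtain ⟨g, hg, hg0⟩ := hc₀
  have hgr : aeval r g = 0 := by
    apply hrinj
    rw [map_zero, ← hg0, ← hrc₀, aeval_def, aeval_def, hom_eval₂]
    rfl
  have hrP : r ∉ P := by
    have := sub_intCast_notMem P hP.ne_top h2 r g hgr 0 (by
      exact_mod_cast gleason_eval_zmod_two_ne_zero (k + 1) 1 (by omega) (by omega) 0
        (fun j => by simp only [eval_zero_aPoly_zmod_two, one_dvd]) g hg)
    simpa using this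
  have hr1P : r + 1 ∉ P := by
    have := sub_intCast_notMem P hP.ne_top h2 r g hgr (-1) (by
      have h1 : ((-1 : ℤ) : ZMod 2) = 1 := by decide
      rw [h1]
      refine gleason_eval_zmod_two_ne_zero (k + 1) 2 (by omega) (by omega) 1 (fun j => ?_) g hg
      rw [eval_one_aPoly_zmod_two, ZMod.natCast_eq_zero_iff])
    simpa using this
  have hr2P : r + 2 ∉ P := fun h => hrP ((P.add_mem_iff_left h2).1 h)
  have hr0 : r ≠ 0 := fun h => hrP (h ▸ P.zero_mem)
  have hr10 : r + 1 ≠ 0 := fun h => hr1P (h ▸ P.zero_mem)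
  refine ⟨k + 1, by omega, ?_⟩
  by_contra! hcomm
  set E := (fIter 2 c (k + 1)).SplittingField
  have hmem : ∀ β x : AlgebraicClosure E,
      β ^ 2 = algebraMap K _ (-(c * (c + 2))) → x ^ 2 = β - algebraMap K _ c →
      ∃ y : E, algebraMap E (AlgebraicClosure E) y = x := by
    intro β x hβ hx
    have hev := eval_fIter_eq_zero (algebraMap K (AlgebraicClosure E) c) β x (k + 1) hn
      (by rw [← map_aSeq, hrootc, map_zero])
      (by rw [hβ]; simp only [aSeq, map_neg, map_mul, map_add, map_ofNat]; ring) (by rw [hx]; ring)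
    have hsp := SplittingField.splits (fIter 2 c (k + 1))
    refine Splits.mem_range_of_isRoot hsp ?_ (i := algebraMap E (AlgebraicClosure E)) ?_
    · exact (((monic_fIter_two c (k + 1)).1).map _).ne_zero
    · rw [map_fIter, map_fIter, ← IsScalarTower.algebraMap_apply]
      exact hev
  obtain ⟨β', hβ'⟩ := IsAlgClosed.exists_pow_nat_eq
    (algebraMap K (AlgebraicClosure E) (-(c * (c + 2)))) two_pos
  obtain ⟨γ', hγ'⟩ := IsAlgClosed.exists_pow_nat_eq (β' - algebraMap K (AlgebraicClosure E) c)
    two_pos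
  obtain ⟨δ', hδ'⟩ := IsAlgClosed.exists_pow_nat_eq (-β' - algebraMap K (AlgebraicClosure E) c)
    two_pos
  obtain ⟨γ, rfl⟩ := hmem β' γ' hβ' hγ'
  obtain ⟨δ, rfl⟩ := hmem (-β') δ' (by rw [neg_sq, hβ']) hδ'
  have hiE : Function.Injective (algebraMap E (AlgebraicClosure E)) := (algebraMap E _).injective
  obtain rfl : β' = algebraMap E (AlgebraicClosure E) (γ ^ 2 + algebraMap K E c) := by
    rw [map_add, map_pow, hγ', ← IsScalarTower.algebraMap_apply]; ring
  have hfin : FiniteDimensional K E := inferInstance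
  have hgal : IsGalois K E := IsGalois.mk
  have key := exists_isSquare_of_forall_commute (K := K) (E := E) hcomm (-(c * (c + 2)))
    (2 * (c * (c + 1))) c
    (by
      rw [← hr]
      have h20 : (2 : 𝓞 K) ≠ 0 := two_ne_zero
      simpa using (map_ne_zero_iff (algebraMap (𝓞 K) K)
        NumberField.RingOfIntegers.coe_injective).2 (mul_ne_zero h20 (mul_ne_zero hr0 hr10)))
    (by ring) (γ ^ 2 + algebraMap K E c) γ δ
    (hiE (by rw [map_pow, hβ', ← IsScalarTower.algebraMap_apply])) (by ring)
    (hiE (by rw [map_pow, hδ', map_sub, map_neg, ← IsScalarTower.algebraMap_apply]))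
  have hw : r * (r + 1) ∉ P := fun h => (hP.isPrime.mem_or_mem h).elim hrP hr1P
  have hb : -(r * (r + 2)) ∉ P := fun h =>
    (hP.isPrime.mem_or_mem (neg_mem_iff.1 h)).elim hrP hr2P
  rcases key with h | h | h
  · exact not_isSquare_neg_mul_add_two P h2 h22 r hrP hr1P (by
      simpa only [map_neg, map_mul, map_add, map_one, map_ofNat, hr] using h)
  · exact not_isSquare_two_mul P h2 h22 _ hw (by
      simpa only [map_neg, map_mul, map_add, map_one, map_ofNat, hr] using h)
  · exact not_isSquare_two_mul P h2 h22 (r * (r + 1) * (-(r * (r + 2))))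
      (fun h => (hP.isPrime.mem_or_mem h).elim hw hb) (by
        simpa only [map_neg, map_mul, map_add, map_one, map_ofNat, hr, mul_assoc] using h)
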